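/- arXiv:1901.08219 — 2 statements merged into one kernel-verified Lean document; each statement's English description precedes it below -/
import Mathlib

section
/- Suppose every optimal cluster C_l has |C_l| ≥ ε·z for l = 1,...,k. Then, running Algorithm 1 with t = (k+√k)/(1−η) rounds, the output set E is, with constant probability, a (4, O(1/ε))-approximation for the problem of (k,z)_0-center clustering: φ_0(X,E) ≤ 4·r_opt while excluding exactly z outliers, and |E| = O((k/ε)·log(1/η)). -/
set_option autoImplicit false

open Metric
open scoped ENNReal NNReal Classical

noncomputable def costSet {X : Type*} [MetricSpace X] (X' A : Finset X) : ℝ :=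
  sSup ((fun p => Metric.infDist p (A : Set X)) '' (X' : Set X))

/-- `phi ε z A` is `φ_ε(X, A)`: the smallest clustering cost (radius) achievable with
center set `A` after excluding at most `(1+ε)z` outliers from `X`. -/
noncomputable def phi {X : Type*} [MetricSpace X] [Fintype X] (ε : ℝ) (z : ℕ) (A : Finset X) : ℝ :=
  sInf {r : ℝ | ∃ X' : Finset X, (Fintype.card X : ℝ) - (1 + ε) * z ≤ X'.card ∧ r = costSet X' A}

/-- The distribution of the set formed by `m` independent uniform draws from `s`. -/
noncomputable def sampleMany {X : Type*} [DecidableEq X] (s : Finset X) (hs : s.Nonempty) :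
    ℕ → PMF (Finset X)
  | 0 => PMF.pure ∅
  | m + 1 => (PMF.uniformOfFinset s hs).bind fun v => (sampleMany s hs m).map (insert v)

/-- Algorithm 1: initialize `E` with `m₀` uniform random vertices of `X`; in each of the
subsequent rounds, let `F E` be a set of the `(1+ε)z` vertices farthest from `E`
(`F` is a fixed tie-breaking selector) and add `m₁` uniform random vertices of `F E` to `E`.
`algorithm1 F hF m₀ m₁ j` is the distribution of `E` after the initialization plus `j`
further rounds. -/
noncomputable def algorithm1 {X : Type*} [MetricSpace X] [Fintype X] [DecidableEq X] [Nonempty X]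
    (F : Finset X → Finset X) (hF : ∀ E, (F E).Nonempty) (m₀ m₁ : ℕ) : ℕ → PMF (Finset X)
  | 0 => sampleMany Finset.univ Finset.univ_nonempty m₀
  | j + 1 => (algorithm1 F hF m₀ m₁ j).bind fun E =>
      (sampleMany (F E) (hF E) m₁).map (fun s => E ∪ s)

/-- The expectation of an `ℝ≥0∞`-valued function under a probability mass function. -/
noncomputable def expect {α : Type*} (p : PMF α) (f : α → ℝ≥0∞) : ℝ≥0∞ := ∑' a, p a * f a

section Expectation

variable {α β : Type*}

theorem expect_mono (p : PMF α) {f g : α → ℝ≥0∞} (h : ∀ a, f a ≤ g a) :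
    expect p f ≤ expect p g :=
  ENNReal.tsum_le_tsum fun a => mul_le_mul_right (h a) _

theorem expect_const (p : PMF α) (c : ℝ≥0∞) : expect p (fun _ => c) = c := by
  simp [expect, ENNReal.tsum_mul_right, p.tsum_coe]

theorem expect_add (p : PMF α) (f g : α → ℝ≥0∞) :
    expect p (fun a => f a + g a) = expect p f + expect p g := by
  simp [expect, mul_add, ENNReal.tsum_add]

theorem expect_const_mul (p : PMF α) (c : ℝ≥0∞) (f : α → ℝ≥0∞) :
    expect p (fun a => c * f a) = c * expect p f := by
  simp [expect, mul_left_comm, ENNReal.tsum_mul_left]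

theorem expect_pure (a : α) (f : α → ℝ≥0∞) : expect (PMF.pure a) f = f a := by
  unfold expect
  rw [tsum_eq_single a]
  · simp
  · intro b hb
    simp [PMF.pure_apply, hb]

theorem expect_bind (p : PMF α) (k : α → PMF β) (f : β → ℝ≥0∞) :
    expect (p.bind k) f = expect p fun a => expect (k a) f := by
  simp only [expect, PMF.bind_apply, ← ENNReal.tsum_mul_right, ← ENNReal.tsum_mul_left]
  rw [ENNReal.tsum_comm]
  simp only [mul_assoc]

theorem expect_map (p : PMF α) (g : α → β) (f : β → ℝ≥0∞) :
    expect (p.map g) f = expect p fun a => f (g a) := by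
  rw [PMF.map, expect_bind]
  simp only [Function.comp_apply, expect_pure]

theorem one_sub_expect_le (p : PMF α) (f : α → ℝ≥0∞) :
    1 - expect p f ≤ expect p fun a => 1 - f a := by
  rw [tsub_le_iff_right, ← expect_add]
  calc (1 : ℝ≥0∞) = expect p fun _ => 1 := (expect_const p 1).symm
    _ ≤ _ := expect_mono p fun a => le_tsub_add

theorem toOuterMeasure_eq_expect (p : PMF α) (s : Set α) :
    p.toOuterMeasure s = expect p (s.indicator 1) := by
  rw [PMF.toOuterMeasure_apply]
  refine tsum_congr fun a => ?_
  by_cases h : a ∈ s <;> simp [h]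

theorem expect_uniformOfFinset_indicator_le [DecidableEq α] (s G : Finset α) (hs : s.Nonempty)
    {x : ℝ} (hx : ((s \ G).card : ℝ) ≤ x * s.card) :
    expect (PMF.uniformOfFinset s hs) (Set.indicator {v | v ∉ G} 1) ≤ ENNReal.ofReal x := by
  have hpos : (0 : ℝ) < s.card := by exact_mod_cast hs.card_pos
  rw [← toOuterMeasure_eq_expect, PMF.toOuterMeasure_uniformOfFinset_apply]
  have : ((s \ G).card : ℝ) / s.card ≤ x := (div_le_iff₀ hpos).2 hx
  refine le_trans (le_of_eq ?_) (ENNReal.ofReal_le_ofReal this)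
  rw [ENNReal.ofReal_div_of_pos hpos, ENNReal.ofReal_natCast, ENNReal.ofReal_natCast]
  congr 3
  ext v
  simp

end Expectation

section Sampling

variable {X : Type*} [DecidableEq X]

theorem expect_sampleMany_disjoint_le (s G : Finset X) (hs : s.Nonempty) {x : ℝ}
    (hx : ((s \ G).card : ℝ) ≤ x * s.card) (m : ℕ) :
    expect (sampleMany s hs m) (Set.indicator {S | Disjoint S G} 1) ≤ ENNReal.ofReal x ^ m := by
  induction m with
  | zero => simp [sampleMany, expect_pure]
  | succ m ih =>
    rw [sampleMany, expect_bind]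
    simp only [expect_map]
    have key : ∀ v S, (Set.indicator {S | Disjoint S G} 1 (insert v S) : ℝ≥0∞) =
        Set.indicator {v | v ∉ G} 1 v * Set.indicator {S | Disjoint S G} 1 S := by
      intro v S
      by_cases h1 : v ∈ G <;> by_cases h2 : Disjoint S G <;>
        simp [Finset.disjoint_insert_left, h1, h2]
    simp only [key, expect_const_mul]
    simp only [mul_comm _ (expect (sampleMany s hs m) _), expect_const_mul]
    rw [pow_succ]
    exact mul_le_mul' ih (expect_uniformOfFinset_indicator_le s G hs hx)

theorem card_le_of_mem_support_sampleMany (s : Finset X) (hs : s.Nonempty) (m : ℕ) :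
    ∀ S ∈ (sampleMany s hs m).support, S.card ≤ m := by
  induction m with
  | zero => simp [sampleMany]
  | succ m ih =>
    intro S hS
    rw [sampleMany, PMF.mem_support_bind_iff] at hS
    obtain ⟨v, -, hS⟩ := hS
    rw [PMF.mem_support_map_iff] at hS
    obtain ⟨S', hS', rfl⟩ := hS
    exact (Finset.card_insert_le _ _).trans (Nat.succ_le_succ (ih S' hS'))

theorem one_sub_pow_le_of_log_le {x η : ℝ} (hx0 : 0 < x) (hx1 : x ≤ 1) (hη : 0 < η) {m : ℕ}
    (hm : 1 / x * Real.log (1 / η) ≤ m) : (1 - x) ^ m ≤ η := by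
  have h1 : (1 - x) ^ m ≤ Real.exp (-x) ^ m :=
    pow_le_pow_left₀ (by linarith) (by linarith [Real.add_one_le_exp (-x)]) m
  refine h1.trans ?_
  rw [← Real.exp_nat_mul, ← Real.le_log_iff_exp_le hη]
  rw [one_div η, Real.log_inv, one_div, inv_mul_eq_div, div_le_iff₀ hx0] at hm
  linarith

theorem expect_sampleMany_disjoint_le_of_log_le (s G : Finset X) (hs : s.Nonempty) {x η : ℝ}
    (hx0 : 0 < x) (hx1 : x ≤ 1) (hη : 0 < η) (hx : ((s \ G).card : ℝ) ≤ (1 - x) * s.card) {m : ℕ}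
    (hm : 1 / x * Real.log (1 / η) ≤ m) :
    expect (sampleMany s hs m) (Set.indicator {S | Disjoint S G} 1) ≤ ENNReal.ofReal η := by
  refine (expect_sampleMany_disjoint_le s G hs hx m).trans ?_
  rw [← ENNReal.ofReal_pow (by linarith)]
  exact ENNReal.ofReal_le_ofReal (one_sub_pow_le_of_log_le hx0 hx1 hη hm)

end Sampling

section Algorithm

variable {X : Type*} [MetricSpace X] [Fintype X] [DecidableEq X] [Nonempty X]

theorem card_le_of_mem_support_algorithm1 (F : Finset X → Finset X) (hF : ∀ E, (F E).Nonempty)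
    (m₀ m₁ j : ℕ) : ∀ E ∈ (algorithm1 F hF m₀ m₁ j).support, E.card ≤ m₀ + j * m₁ := by
  induction j with
  | zero => simpa [algorithm1] using card_le_of_mem_support_sampleMany _ _ m₀
  | succ j ih =>
    intro E hE
    rw [algorithm1, PMF.mem_support_bind_iff] at hE
    obtain ⟨E', hE', hE⟩ := hE
    rw [PMF.mem_support_map_iff] at hE
    obtain ⟨S, hS, rfl⟩ := hE
    have h1 := ih E' hE'
    have h2 := card_le_of_mem_support_sampleMany _ _ m₁ S hS
    have h3 := Finset.card_union_le E' S
    rw [Nat.succ_mul]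
    omega

/-- If each round contracts the expectation of `w` by the factor `a`, then the expectation of
`1 - w` after `i` rounds is controlled by that of `1 - a ^ i * w` after the initialization. -/
theorem expect_algorithm1_ge (F : Finset X → Finset X) (hF : ∀ E, (F E).Nonempty) (m₀ m₁ : ℕ)
    (w : Finset X → ℝ≥0∞) (a : ℝ≥0∞)
    (hstep : ∀ E, expect (sampleMany (F E) (hF E) m₁) (fun S => w (E ∪ S)) ≤ a * w E) (i j : ℕ) :
    expect (sampleMany Finset.univ Finset.univ_nonempty m₀) (fun E => 1 - a ^ (i + j) * w E) ≤
      expect (algorithm1 F hF m₀ m₁ i) (fun E => 1 - a ^ j * w E) := by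
  induction i generalizing j with
  | zero => simp [algorithm1]
  | succ i ih =>
    rw [algorithm1, expect_bind, show i + 1 + j = i + (j + 1) by ring]
    refine (ih (j + 1)).trans (expect_mono _ fun E => ?_)
    rw [expect_map]
    refine le_trans ?_ (one_sub_expect_le _ _)
    rw [expect_const_mul, pow_succ, mul_assoc]
    exact tsub_le_tsub_left (mul_le_mul_right (hstep E) _) _

end Algorithm

/-- Every point of every cluster is within distance `R` of `E`. -/
def CoversWithin {X : Type*} [MetricSpace X] {k : ℕ} (C : Fin k → Finset X) (R : ℝ) (E : Finset X) : Prop :=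
  ∀ l, ∀ p ∈ C l, ∃ e ∈ E, dist p e ≤ R

theorem CoversWithin.mono {X : Type*} [MetricSpace X] {k : ℕ} {C : Fin k → Finset X} {R : ℝ} {E E' : Finset X}
    (h : CoversWithin C R E) (hE : E ⊆ E') : CoversWithin C R E' := fun l p hp =>
  let ⟨e, he, hpe⟩ := h l p hp
  ⟨e, hE he, hpe⟩

/-- The clusters containing no point of `E`. -/
noncomputable def unhit {X : Type*} {k : ℕ} (C : Fin k → Finset X) (E : Finset X) : Finset (Fin k) :=
  Finset.univ.filter fun l => Disjoint (C l) E

theorem unhit_antitone {X : Type*} {k : ℕ} (C : Fin k → Finset X) {E E' : Finset X} (hE : E ⊆ E') :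
    unhit C E' ⊆ unhit C E := by
  intro l hl
  simp only [unhit, Finset.mem_filter, Finset.mem_univ, true_and] at hl ⊢
  exact hl.mono_right hE

theorem card_unhit_union_lt {X : Type*} [DecidableEq X] {k : ℕ} (C : Fin k → Finset X) {E S : Finset X}
    (h : ¬ Disjoint S ((unhit C E).biUnion C)) :
    (unhit C (E ∪ S)).card < (unhit C E).card := by
  refine Finset.card_lt_card ((Finset.ssubset_iff_of_subset
    (unhit_antitone C Finset.subset_union_left)).2 ?_)
  obtain ⟨x, hxS, hx⟩ := Finset.not_disjoint_iff.1 h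
  obtain ⟨l, hl, hxl⟩ := Finset.mem_biUnion.1 hx
  refine ⟨l, hl, fun hl' => ?_⟩
  simp only [unhit, Finset.mem_filter, Finset.mem_univ, true_and] at hl'
  exact Finset.disjoint_left.1 hl' hxl (Finset.mem_union_right _ hxS)

section Potential

variable {X : Type*} [MetricSpace X] [DecidableEq X] {k : ℕ}

/-- The potential function: zero once `E` covers all clusters, and exponential in the number of
unhit clusters before that. -/
noncomputable def potential (C : Fin k → Finset X) (R s : ℝ) (E : Finset X) : ℝ≥0∞ :=
  if CoversWithin C R E then 0 else ENNReal.ofReal (Real.exp (s * (((unhit C E).card : ℝ) - 1)))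

theorem phi_zero_le_of_coversWithin [Fintype X] (C : Fin k → Finset X) (R : ℝ) (hR : 0 ≤ R) (z : ℕ)
    (hcard : (Fintype.card X : ℝ) - z ≤ (Finset.univ.biUnion C).card) {E : Finset X}
    (hE : CoversWithin C R E) : phi 0 z E ≤ R := by
  have hnonneg : ∀ X' : Finset X, 0 ≤ costSet X' E := by
    intro X'
    refine Real.sSup_nonneg ?_
    rintro _ ⟨p, -, rfl⟩
    exact infDist_nonneg
  have hle : costSet (Finset.univ.biUnion C) E ≤ R := by
    refine Real.sSup_le ?_ hR
    rintro _ ⟨p, hp, rfl⟩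
    obtain ⟨l, -, hl⟩ := Finset.mem_biUnion.1 (Finset.mem_coe.1 hp)
    obtain ⟨e, he, hpe⟩ := hE l p hl
    exact (infDist_le_dist_of_mem (Finset.mem_coe.2 he)).trans hpe
  refine le_trans (csInf_le ⟨0, ?_⟩ ⟨Finset.univ.biUnion C, ?_, rfl⟩) hle
  · rintro _ ⟨X', -, rfl⟩
    exact hnonneg X'
  · simpa using hcard

theorem potential_union_le (C : Fin k → Finset X) (R : ℝ) {s : ℝ} (hs : 0 ≤ s)
    {E G : Finset X} (hG : G ⊆ (unhit C E).biUnion C) (S : Finset X) :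
    potential C R s (E ∪ S) ≤ potential C R s E * (ENNReal.ofReal (Real.exp (-s)) +
      ENNReal.ofReal (1 - Real.exp (-s)) * Set.indicator {S | Disjoint S G} 1 S) := by
  have hsub : E ⊆ E ∪ S := Finset.subset_union_left
  by_cases h' : CoversWithin C R (E ∪ S)
  · simp [potential, h']
  have h : ¬ CoversWithin C R E := fun h => h' (h.mono hsub)
  rw [potential, potential, if_neg h', if_neg h]
  have hexp : Real.exp (-s) ≤ 1 := Real.exp_le_one_iff.2 (by linarith)
  by_cases hd : Disjoint S G
  · rw [Set.indicator_of_mem (by exact hd), Pi.one_apply, mul_one,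
      ← ENNReal.ofReal_add (Real.exp_pos _).le (by linarith), add_sub_cancel, ENNReal.ofReal_one,
      mul_one]
    have hcard : ((unhit C (E ∪ S)).card : ℝ) ≤ (unhit C E).card := by
      exact_mod_cast Finset.card_le_card (unhit_antitone C hsub)
    gcongr
  · rw [Set.indicator_of_notMem (by exact hd), mul_zero, add_zero,
      ← ENNReal.ofReal_mul (Real.exp_pos _).le, ← Real.exp_add]
    have hcard : ((unhit C (E ∪ S)).card : ℝ) + 1 ≤ (unhit C E).card := by
      exact_mod_cast card_unhit_union_lt C fun hd' => hd (hd'.mono_right hG)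
    refine ENNReal.ofReal_le_ofReal (Real.exp_le_exp.2 ?_)
    nlinarith

/-- While `E` does not cover the clusters within `4 * r`, the farthest points `Q` either contain
a whole unhit cluster or meet only unhit clusters. -/
theorem exists_cluster_subset_or_inter_subset (C : Fin k → Finset X) (o : Fin k → X) {r : ℝ}
    (hcover : ∀ l, ∀ p ∈ C l, dist p (o l) ≤ r) {E Q : Finset X}
    (hE : ¬ CoversWithin C (4 * r) E)
    (hfar : ∀ p ∉ Q, ∀ q ∈ Q, infDist p (E : Set X) ≤ infDist q (E : Set X)) :
    (∃ l, C l ⊆ Q ∩ (unhit C E).biUnion C) ∨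
      Q ∩ Finset.univ.biUnion C ⊆ Q ∩ (unhit C E).biUnion C := by
  have hdiam : ∀ l, ∀ p ∈ C l, ∀ q ∈ C l, dist p q ≤ 2 * r := fun l p hp q hq => by
    linarith [dist_triangle_right p q (o l), hcover l p hp, hcover l q hq]
  simp only [CoversWithin, not_forall, not_exists, not_and, not_le] at hE
  obtain ⟨l, p, hp, hpE⟩ := hE
  have hr : 0 ≤ r := dist_nonneg.trans (hcover l p hp)
  by_cases hl : C l ⊆ Q
  · refine Or.inl ⟨l, Finset.subset_inter hl (Finset.subset_biUnion_of_mem C ?_)⟩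
    simp only [unhit, Finset.mem_filter, Finset.mem_univ, true_and]
    refine Finset.disjoint_left.2 fun e he heE => ?_
    linarith [hpE e heE, hdiam l p hp e he]
  · obtain ⟨x, hx, hxQ⟩ := Finset.not_subset.1 hl
    refine Or.inr fun q hq => ?_
    obtain ⟨hqQ, hqC⟩ := Finset.mem_inter.1 hq
    obtain ⟨l', -, hql'⟩ := Finset.mem_biUnion.1 hqC
    refine Finset.mem_inter.2 ⟨hqQ, Finset.mem_biUnion.2 ⟨l', ?_, hql'⟩⟩
    simp only [unhit, Finset.mem_filter, Finset.mem_univ, true_and]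
    refine Finset.disjoint_left.2 fun e he heE => ?_
    have h1 : infDist x (E : Set X) ≤ 2 * r :=
      (hfar x hxQ q hqQ).trans ((infDist_le_dist_of_mem (Finset.mem_coe.2 heE)).trans
        (hdiam l' q hql' e he))
    obtain ⟨y, hy, hxy⟩ := E.finite_toSet.isCompact.exists_infDist_eq_dist ⟨e, heE⟩ x
    linarith [hpE y hy, dist_triangle p x y, hdiam l p hp x hx]

theorem card_farthest_sdiff_le [Fintype X] (C : Fin k → Finset X) (o : Fin k → X) {r ε : ℝ} {z : ℕ}
    (hcover : ∀ l, ∀ p ∈ C l, dist p (o l) ≤ r) (hclsize : ∀ l, ε * z ≤ ((C l).card : ℝ))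
    (hcard : Fintype.card X ≤ (Finset.univ.biUnion C).card + z) {E Q : Finset X}
    (hQcard : (Q.card : ℝ) = (1 + ε) * z) (hE : ¬ CoversWithin C (4 * r) E)
    (hfar : ∀ p ∉ Q, ∀ q ∈ Q, infDist p (E : Set X) ≤ infDist q (E : Set X)) :
    ((Q \ (Q ∩ (unhit C E).biUnion C)).card : ℝ) ≤ z := by
  rcases exists_cluster_subset_or_inter_subset C o hcover hE hfar with ⟨l, hl⟩ | h
  · have h1 : ((C l).card : ℝ) ≤ (Q ∩ (unhit C E).biUnion C).card := by
      exact_mod_cast Finset.card_le_card hl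
    have h2 : ((Q \ (Q ∩ (unhit C E).biUnion C)).card : ℝ) +
        (Q ∩ (unhit C E).biUnion C).card = Q.card := by
      exact_mod_cast Finset.card_sdiff_add_card_eq_card Finset.inter_subset_left
    linarith [hclsize l]
  · have h1 : Q \ (Q ∩ (unhit C E).biUnion C) ⊆ (Finset.univ.biUnion C)ᶜ := by
      intro q hq
      rw [Finset.mem_sdiff] at hq
      rw [Finset.mem_compl]
      exact fun hqC => hq.2 (h (Finset.mem_inter.2 ⟨hq.1, hqC⟩))
    have h2 := Finset.card_le_card h1
    rw [Finset.card_compl] at h2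
    exact_mod_cast h2.trans (by omega)

theorem expect_potential_union_le [Fintype X] (C : Fin k → Finset X) (o : Fin k → X)
    {r ε η s : ℝ} {z m : ℕ} (hs : 0 ≤ s) (hε : 0 < ε) (hη : 0 < η)
    (hcover : ∀ l, ∀ p ∈ C l, dist p (o l) ≤ r) (hclsize : ∀ l, ε * z ≤ ((C l).card : ℝ))
    (hcard : Fintype.card X ≤ (Finset.univ.biUnion C).card + z) (E Q : Finset X)
    (hQ : Q.Nonempty) (hQcard : (Q.card : ℝ) = (1 + ε) * z)
    (hfar : ∀ p ∉ Q, ∀ q ∈ Q, infDist p (E : Set X) ≤ infDist q (E : Set X))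
    (hm : ((1 + ε) / ε) * Real.log (1 / η) ≤ m) :
    expect (sampleMany Q hQ m) (fun S => potential C (4 * r) s (E ∪ S)) ≤
      ENNReal.ofReal (Real.exp (-s) + (1 - Real.exp (-s)) * η) * potential C (4 * r) s E := by
  by_cases hE : CoversWithin C (4 * r) E
  · have : ∀ S, potential C (4 * r) s (E ∪ S) = 0 := fun S =>
      if_pos (hE.mono Finset.subset_union_left)
    simp only [this, expect_const, zero_le]
  have hexp : Real.exp (-s) ≤ 1 := Real.exp_le_one_iff.2 (by linarith)
  refine (expect_mono _ fun S => potential_union_le C (4 * r) hs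
    (Finset.inter_subset_right (s₁ := Q)) S).trans ?_
  rw [expect_const_mul, expect_add, expect_const, expect_const_mul, mul_comm,
    ENNReal.ofReal_add (Real.exp_pos _).le (mul_nonneg (by linarith) hη.le),
    ENNReal.ofReal_mul (by linarith : (0 : ℝ) ≤ 1 - Real.exp (-s))]
  gcongr
  refine expect_sampleMany_disjoint_le_of_log_le Q _ hQ (x := ε / (1 + ε)) (by positivity)
    ((div_le_one (by linarith)).2 (by linarith)) hη ?_ (by rwa [one_div_div])
  refine (card_farthest_sdiff_le C o hcover hclsize hcard hQcard hE hfar).trans (le_of_eq ?_)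
  rw [hQcard]
  field_simp
  ring

theorem potential_le_of_not_disjoint (C : Fin k → Finset X) (R : ℝ) {s : ℝ} (hs : 0 ≤ s)
    {E : Finset X} (hE : ¬ Disjoint E (Finset.univ.biUnion C)) :
    potential C R s E ≤ ENNReal.ofReal (Real.exp (s * (k - 2))) := by
  rw [potential]
  split_ifs
  · exact zero_le
  obtain ⟨x, hxE, hx⟩ := Finset.not_disjoint_iff.1 hE
  obtain ⟨l, -, hl⟩ := Finset.mem_biUnion.1 hx
  have hlt : (unhit C E).card < k := by
    have : unhit C E ⊂ Finset.univ := by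
      refine (Finset.ssubset_iff_of_subset (Finset.subset_univ _)).2 ⟨l, Finset.mem_univ l, ?_⟩
      simp only [unhit, Finset.mem_filter, Finset.mem_univ, true_and]
      exact Finset.not_disjoint_iff.2 ⟨x, hl, hxE⟩
    simpa using Finset.card_lt_card this
  have hcard : ((unhit C E).card : ℝ) + 1 ≤ k := by exact_mod_cast hlt
  refine ENNReal.ofReal_le_ofReal (Real.exp_le_exp.2 (mul_le_mul_of_nonneg_left ?_ hs))
  linarith

end Potential

theorem one_sub_potential_le {X : Type*} [MetricSpace X] {k : ℕ} (C : Fin k → Finset X)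
    (o : Fin k → X) {r s : ℝ} (hs : 0 ≤ s)
    (hcover : ∀ l, ∀ p ∈ C l, dist p (o l) ≤ r) (E : Finset X) :
    1 - potential C (4 * r) s E ≤ Set.indicator {E | CoversWithin C (4 * r) E} 1 E := by
  by_cases hE : CoversWithin C (4 * r) E
  · simp [hE]
  have hE' := hE
  simp only [CoversWithin, not_forall, not_exists, not_and, not_le] at hE'
  obtain ⟨l, p, hp, hpE⟩ := hE'
  have hl : l ∈ unhit C E := by
    simp only [unhit, Finset.mem_filter, Finset.mem_univ, true_and]
    refine Finset.disjoint_left.2 fun e he heE => ?_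
    linarith [hpE e heE, dist_triangle_right p e (o l), hcover l p hp, hcover l e he,
      dist_nonneg.trans (hcover l p hp)]
  have hcard : (1 : ℝ) ≤ (unhit C E).card := by
    exact_mod_cast Finset.card_pos.2 ⟨l, hl⟩
  have h1 : (1 : ℝ≥0∞) ≤ potential C (4 * r) s E := by
    rw [potential, if_neg hE]
    refine ENNReal.one_le_ofReal.2 (Real.one_le_exp (mul_nonneg hs (by linarith)))
  rw [tsub_eq_zero_of_le h1]
  exact zero_le

/-- The Chernoff-type estimate for `T` rounds, with the exponential parameter `1 / √k`. -/
theorem pow_mul_exp_le {k T : ℕ} {η : ℝ} (hk : 1 ≤ k) (hη : η ∈ Set.Ioo (0 : ℝ) 1)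
    (hT : ((k : ℝ) + Real.sqrt k) / (1 - η) ≤ T + 1) {s : ℝ} (hs : s = 1 / Real.sqrt k) :
    (Real.exp (-s) + (1 - Real.exp (-s)) * η) ^ T * Real.exp (s * (k - 2)) ≤
      Real.exp (-(1 - η) / 4) := by
  obtain ⟨hη0, hη1⟩ := hη
  have hk1 : (1 : ℝ) ≤ Real.sqrt k := Real.one_le_sqrt.2 (by exact_mod_cast hk)
  have hk2 : (k : ℝ) = Real.sqrt k ^ 2 := (Real.sq_sqrt (by positivity)).symm
  have hs0 : 0 < s := by rw [hs]; positivity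
  have hs1 : s ≤ 1 := by rw [hs]; exact (div_le_one (by linarith)).2 hk1
  have hsk : s * Real.sqrt k = 1 := by rw [hs]; field_simp
  have hexp : Real.exp (-s) ≤ 1 - s + s ^ 2 / 2 := by
    have h := Real.quadratic_le_exp_of_nonneg hs0.le
    rw [Real.exp_neg, inv_le_iff_one_le_mul₀ (Real.exp_pos s)]
    nlinarith [mul_le_mul_of_nonneg_left h (by nlinarith : 0 ≤ 1 - s + s ^ 2 / 2),
      sq_nonneg (s ^ 2)]
  have hT' : (k : ℝ) + Real.sqrt k - (1 - η) ≤ (1 - η) * T := by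
    rw [div_le_iff₀ (by linarith)] at hT
    linarith
  have hbase : Real.exp (-s) + (1 - Real.exp (-s)) * η ≤
      Real.exp (-((1 - η) * (s - s ^ 2 / 2))) := by
    nlinarith [Real.add_one_le_exp (-((1 - η) * (s - s ^ 2 / 2)))]
  have hbase0 : 0 ≤ Real.exp (-s) + (1 - Real.exp (-s)) * η := by
    nlinarith [Real.exp_pos (-s)]
  calc _ ≤ Real.exp (-((1 - η) * (s - s ^ 2 / 2))) ^ T * Real.exp (s * (k - 2)) := by gcongr
    _ = Real.exp (-((1 - η) * T * (s - s ^ 2 / 2)) + s * (k - 2)) := by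
      rw [← Real.exp_nat_mul, ← Real.exp_add]
      ring_nf
    _ ≤ _ := Real.exp_le_exp.2 ?_
  have h1 : (k + Real.sqrt k - (1 - η)) * (s - s ^ 2 / 2) ≤ (1 - η) * T * (s - s ^ 2 / 2) :=
    mul_le_mul_of_nonneg_right hT' (by nlinarith)
  have h2 : s * k = Real.sqrt k := by linear_combination s * hk2 + Real.sqrt k * hsk
  have h3 : s ^ 2 * k = 1 := by linear_combination s * h2 + hsk
  have h4 : s ^ 2 * Real.sqrt k = s := by linear_combination s * hsk
  nlinarith

/-- Theorem 2: if every optimal cluster has at least `ε·z` points, then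
Algorithm 1 run for `t = (k+√k)/(1-η)` rounds outputs, with constant probability
(`(1-η)(1-e^{-(1-η)/4})`), a set `E` with `φ_0(X,E) ≤ 4·r_opt` — i.e. a
`(4, O(1/ε))`-approximation excluding exactly `z` outliers — of size
`O((k/ε)·log(1/η))`. -/
theorem algorithm1_four_approx_exact_outliers
    {X : Type*} [MetricSpace X] [Fintype X] [DecidableEq X] [Nonempty X]
    (n k z : ℕ) (hn : Fintype.card X = n) (hz : 0 < z) (hzn : z < n) (hk : 1 ≤ k)
    (Xopt : Finset X) (C : Fin k → Finset X) (o : Fin k → X)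
    (ropt : ℝ) (hropt0 : 0 ≤ ropt)
    (hXoptcard : Xopt.card = n - z)
    (hunion : Finset.univ.biUnion C = Xopt)
    (hdisj : ∀ i j : Fin k, i ≠ j → Disjoint (C i) (C j))
    (hcover : ∀ l : Fin k, ∀ p ∈ C l, dist p (o l) ≤ ropt)
    (hoptmin : ∀ A : Finset X, A.card = k → ropt ≤ phi 0 z A)
    (ε η : ℝ) (hε : 0 < ε) (hη : η ∈ Set.Ioo (0 : ℝ) 1)
    (hclsize : ∀ l : Fin k, ε * z ≤ ((C l).card : ℝ))
    (F : Finset X → Finset X) (hF : ∀ E, (F E).Nonempty)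
    (hFcard : ∀ E, ((F E).card : ℝ) = (1 + ε) * z)
    (hFfar : ∀ E : Finset X, ∀ p ∉ F E, ∀ q ∈ F E,
      infDist p (E : Set X) ≤ infDist q (E : Set X))
    (m₀ m₁ t : ℕ)
    (hm₀ : m₀ = ⌈(1 / (1 - (z : ℝ) / n)) * Real.log (1 / η)⌉₊)
    (hm₁ : m₁ = ⌈((1 + ε) / ε) * Real.log (1 / η)⌉₊)
    (ht : t = ⌈((k : ℝ) + Real.sqrt k) / (1 - η)⌉₊) :
    ENNReal.ofReal ((1 - η) * (1 - Real.exp (-(1 - η) / 4))) ≤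
      (algorithm1 F hF m₀ m₁ (t - 1)).toOuterMeasure
        {E : Finset X | phi 0 z E ≤ 4 * ropt} ∧
    ∀ E ∈ (algorithm1 F hF m₀ m₁ (t - 1)).support, E.card ≤ m₀ + (t - 1) * m₁ := by
  have hT : t - 1 + 1 = t := by
    refine Nat.sub_add_cancel ?_
    rw [ht, Nat.one_le_ceil_iff]
    have : (1 : ℝ) ≤ k := by exact_mod_cast hk
    exact div_pos (by positivity) (by linarith [hη.2])
  refine ⟨?_, card_le_of_mem_support_algorithm1 F hF m₀ m₁ (t - 1)⟩
  obtain ⟨hη0, hη1⟩ := hη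
  set s : ℝ := 1 / Real.sqrt k with hs
  have hs0 : 0 ≤ s := by positivity
  have hcard : Fintype.card X = (Finset.univ.biUnion C).card + z := by
    rw [hunion, hXoptcard, hn]; omega
  set a : ℝ := Real.exp (-s) + (1 - Real.exp (-s)) * η with ha
  have ha0 : 0 ≤ a := by
    have : Real.exp (-s) ≤ 1 := Real.exp_le_one_iff.2 (by linarith)
    nlinarith [Real.exp_pos (-s)]
  have hinit : expect (sampleMany Finset.univ Finset.univ_nonempty m₀)
      (Set.indicator {E | Disjoint E (Finset.univ.biUnion C)} 1) ≤ ENNReal.ofReal η := by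
    have hn0 : (0 : ℝ) < n := by exact_mod_cast hz.trans hzn
    have hzn' : (z : ℝ) / n < 1 := (div_lt_one hn0).2 (by exact_mod_cast hzn)
    refine expect_sampleMany_disjoint_le_of_log_le _ _ _ (x := 1 - (z : ℝ) / n) (by linarith)
      (by linarith [div_nonneg (Nat.cast_nonneg (α := ℝ) z) hn0.le]) hη0 ?_
      (hm₀ ▸ Nat.le_ceil _)
    rw [← Finset.compl_eq_univ_sdiff, Finset.card_compl, Finset.card_univ, hcard,
      Nat.add_sub_cancel_left, ← hcard, hn, sub_sub_cancel, div_mul_cancel₀ _ hn0.ne']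
  have hrounds := expect_algorithm1_ge F hF m₀ m₁ (potential C (4 * ropt) s) (ENNReal.ofReal a)
    (fun E => expect_potential_union_le C o hs0 hε hη0 hcover hclsize hcard.le E (F E) (hF E)
      (hFcard E) (hFfar E) (hm₁ ▸ Nat.le_ceil _)) (t - 1) 0
  have hpow : ENNReal.ofReal a ^ (t - 1) * ENNReal.ofReal (Real.exp (s * (k - 2))) ≤
      ENNReal.ofReal (Real.exp (-(1 - η) / 4)) := by
    rw [← ENNReal.ofReal_pow ha0, ← ENNReal.ofReal_mul (pow_nonneg ha0 _)]
    refine ENNReal.ofReal_le_ofReal (pow_mul_exp_le hk ⟨hη0, hη1⟩ ?_ hs)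
    have : ((t - 1 : ℕ) : ℝ) + 1 = t := by exact_mod_cast hT
    rw [this, ht]
    exact Nat.le_ceil _
  calc ENNReal.ofReal ((1 - η) * (1 - Real.exp (-(1 - η) / 4)))
      = (1 - ENNReal.ofReal (Real.exp (-(1 - η) / 4))) * (1 - ENNReal.ofReal η) := by
        rw [mul_comm, ENNReal.ofReal_mul' (by linarith), ENNReal.ofReal_sub _ hη0.le,
          ENNReal.ofReal_sub _ (Real.exp_pos _).le, ENNReal.ofReal_one]
    _ ≤ (1 - ENNReal.ofReal (Real.exp (-(1 - η) / 4))) *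
          expect (sampleMany Finset.univ Finset.univ_nonempty m₀) (fun E =>
            1 - Set.indicator {E | Disjoint E (Finset.univ.biUnion C)} 1 E) := by
        gcongr
        exact (tsub_le_tsub_left hinit 1).trans (one_sub_expect_le _ _)
    _ ≤ expect (sampleMany Finset.univ Finset.univ_nonempty m₀)
          (fun E => 1 - ENNReal.ofReal a ^ (t - 1) * potential C (4 * ropt) s E) := by
        rw [← expect_const_mul]
        refine expect_mono _ fun E => ?_
        by_cases hE : Disjoint E (Finset.univ.biUnion C)
        · simp [hE]
        · rw [Set.indicator_of_notMem (by exact hE), tsub_zero, mul_one]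
          exact tsub_le_tsub_left ((mul_le_mul_right
            (potential_le_of_not_disjoint C (4 * ropt) hs0 hE) _).trans hpow) 1
    _ ≤ expect (algorithm1 F hF m₀ m₁ (t - 1)) (fun E => 1 - potential C (4 * ropt) s E) := by
        simpa using hrounds
    _ ≤ expect (algorithm1 F hF m₀ m₁ (t - 1))
          (Set.indicator {E | phi 0 z E ≤ 4 * ropt} 1) := by
        refine expect_mono _ fun E => (one_sub_potential_le C o hs0 hcover E).trans ?_
        refine Set.indicator_le_indicator_of_subset (fun E hE => ?_) (fun _ => zero_le) E
        refine phi_zero_le_of_coversWithin C _ (by linarith) z ?_ hE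
        rw [hcard]
        push_cast
        linarith
    _ = _ := (toOuterMeasure_eq_expect _ _).symm
end

section
/- Let μ ∈ (0,1), let E be a weighted subset of X, and suppose there is a bijection f between X and E (viewing each vertex q ∈ E of weight w(q) as w(q) overlapping unit-weight copies) such that d(p, f(p)) ≤ μ·r_opt for every p ∈ X. Then for every set H ⊆ X of k vertices, |φ_0(E,H) − φ_0(X,H)| ≤ μ·r_opt, and since φ_0(X,H) ≥ r_opt this gives φ_0(E,H) ∈ (1±μ)·φ_0(X,H); hence E is a μ-coreset of X for k-center clustering with z outliers. -/
set_option autoImplicit false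

open Metric
open scoped ENNReal NNReal Classical

/-- Weighted version of `phi 0`: for a weighted set `S` (weight function `w`),
`phiW w S z A` excludes points of total weight at most `z`. -/
noncomputable def phiW {X : Type*} [MetricSpace X] [DecidableEq X] (w : X → ℕ)
    (S : Finset X) (z : ℕ) (A : Finset X) : ℝ :=
  sInf {r : ℝ | ∃ S' : Finset X, S' ⊆ S ∧ (∑ p ∈ S \ S', w p) ≤ z ∧ r = costSet S' A}

theorem infDist_le_costSet {X : Type*} [MetricSpace X] {X' A : Finset X} {p : X} (hp : p ∈ X') :
    infDist p (A : Set X) ≤ costSet X' A :=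
  le_csSup (X'.finite_toSet.image _).bddAbove ⟨p, hp, rfl⟩

theorem costSet_le {X : Type*} [MetricSpace X] {X' A : Finset X} {r : ℝ} (hr : 0 ≤ r)
    (h : ∀ p ∈ X', infDist p (A : Set X) ≤ r) : costSet X' A ≤ r := by
  refine Real.sSup_le ?_ hr
  rintro _ ⟨p, hp, rfl⟩
  exact h p hp

theorem costSet_nonneg {X : Type*} [MetricSpace X] (X' A : Finset X) : 0 ≤ costSet X' A := by
  refine Real.sSup_nonneg ?_
  rintro _ ⟨p, -, rfl⟩
  exact infDist_nonneg

theorem phi_le_costSet {X : Type*} [MetricSpace X] [Fintype X] {ε : ℝ} {z : ℕ} {X' A : Finset X}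
    (h : (Fintype.card X : ℝ) - (1 + ε) * z ≤ X'.card) : phi ε z A ≤ costSet X' A := by
  refine csInf_le ⟨0, ?_⟩ ⟨X', h, rfl⟩
  rintro _ ⟨Y, -, rfl⟩
  exact costSet_nonneg Y A

theorem phiW_le_costSet {X : Type*} [MetricSpace X] [DecidableEq X] {w : X → ℕ} {S S' : Finset X}
    {z : ℕ} {A : Finset X} (hS : S' ⊆ S) (h : ∑ p ∈ S \ S', w p ≤ z) :
    phiW w S z A ≤ costSet S' A := by
  refine csInf_le ⟨0, ?_⟩ ⟨S', hS, h, rfl⟩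
  rintro _ ⟨Y, -, -, rfl⟩
  exact costSet_nonneg Y A

theorem sum_weight_eq_card_preimage {X : Type*} [Fintype X] [DecidableEq X] {E T : Finset X}
    {w : X → ℕ} {f : X → X}
    (hfw : ∀ q ∈ E, (Finset.univ.filter (fun p : X => f p = q)).card = w q) (hT : T ⊆ E) :
    ∑ q ∈ T, w q = (Finset.univ.filter (fun p : X => f p ∈ T)).card := by
  rw [Finset.card_eq_sum_card_fiberwise (f := f) (t := T) (fun p hp => by simpa using hp)]
  refine Finset.sum_congr rfl fun q hq => ?_
  rw [← hfw q (hT hq)]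
  congr 1
  ext p
  simp only [Finset.mem_filter, Finset.mem_univ, true_and]
  exact ⟨fun h => ⟨h ▸ hq, h⟩, fun h => h.2⟩

theorem phiW_le_phi_add {X : Type*} [MetricSpace X] [Fintype X] [DecidableEq X] {z : ℕ}
    {E H : Finset X} {w : X → ℕ} {f : X → X} {δ : ℝ} (hδ : 0 ≤ δ)
    (hfw : ∀ q ∈ E, (Finset.univ.filter (fun p : X => f p = q)).card = w q)
    (hfd : ∀ p : X, dist p (f p) ≤ δ) : phiW w E z H ≤ phi 0 z H + δ := by
  rw [← sub_le_iff_le_add]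
  refine le_csInf ⟨_, Finset.univ, ?_, rfl⟩ ?_
  · simp
  rintro _ ⟨X', hX', rfl⟩
  rw [sub_le_iff_le_add]
  set S' := E.filter (fun q => infDist q (H : Set X) ≤ costSet X' H + δ) with hS'
  refine (phiW_le_costSet (S' := S') (Finset.filter_subset _ _) ?_).trans
    (costSet_le (add_nonneg (costSet_nonneg _ _) hδ) fun q hq => (Finset.mem_filter.1 hq).2)
  rw [sum_weight_eq_card_preimage hfw Finset.sdiff_subset]
  have hsub : Finset.univ.filter (fun p : X => f p ∈ E \ S') ⊆ X'ᶜ := by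
    intro p hp
    simp only [hS', Finset.mem_filter, Finset.mem_univ, true_and, Finset.mem_sdiff, not_and] at hp
    rw [Finset.mem_compl]
    intro hpX
    refine hp.2 hp.1 ?_
    have h₁ := infDist_le_infDist_add_dist (s := (H : Set X)) (x := f p) (y := p)
    rw [dist_comm] at h₁
    linarith [hfd p, infDist_le_costSet (A := H) hpX]
  refine (Finset.card_le_card hsub).trans ?_
  have h₂ : (X'.card : ℝ) + X'ᶜ.card = Fintype.card X := mod_cast Finset.card_add_card_compl X'
  have h₃ : (X'ᶜ.card : ℝ) ≤ z := by linarith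
  exact_mod_cast h₃

theorem phi_le_phiW_add {X : Type*} [MetricSpace X] [Fintype X] [DecidableEq X] {z : ℕ}
    {E H : Finset X} {w : X → ℕ} {f : X → X} {δ : ℝ} (hδ : 0 ≤ δ) (hfE : ∀ p : X, f p ∈ E)
    (hfw : ∀ q ∈ E, (Finset.univ.filter (fun p : X => f p = q)).card = w q)
    (hfd : ∀ p : X, dist p (f p) ≤ δ) : phi 0 z H ≤ phiW w E z H + δ := by
  rw [← sub_le_iff_le_add]
  refine le_csInf ⟨_, E, subset_rfl, by simp, rfl⟩ ?_
  rintro _ ⟨S', -, hz, rfl⟩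
  rw [sub_le_iff_le_add]
  refine (phi_le_costSet (X' := Finset.univ.filter (fun p : X => f p ∈ S')) ?_).trans
    (costSet_le (add_nonneg (costSet_nonneg _ _) hδ) fun p hp => ?_)
  · rw [sum_weight_eq_card_preimage hfw Finset.sdiff_subset] at hz
    simp only [Finset.mem_sdiff, hfE, true_and] at hz
    have h₁ := Finset.card_filter_add_card_filter_not (s := (Finset.univ : Finset X))
      (fun p : X => f p ∈ S')
    rw [Finset.card_univ] at h₁
    have h₂ : Fintype.card X ≤ (Finset.univ.filter (fun p : X => f p ∈ S')).card + z := by omega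
    have h₃ : (Fintype.card X : ℝ) ≤ (Finset.univ.filter (fun p : X => f p ∈ S')).card + z :=
      mod_cast h₂
    linarith
  · have hp' : f p ∈ S' := (Finset.mem_filter.1 hp).2
    have h₁ := infDist_le_infDist_add_dist (s := (H : Set X)) (x := p) (y := f p)
    linarith [hfd p, infDist_le_costSet (A := H) hp']

/-- from the proof of Theorem 7: if there is a bijection `f` between `X` and
the weighted set `E` (weights counted as multiplicities) moving each point by at most
`μ·r_opt`, then `|φ_0(E,H) - φ_0(X,H)| ≤ μ·r_opt` for every `k`-point center set `H`, and
since `φ_0(X,H) ≥ r_opt` this gives `φ_0(E,H) ∈ (1±μ)·φ_0(X,H)`: `E` is a `μ`-coreset. -/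
theorem bounded_movement_gives_coreset
    {X : Type*} [MetricSpace X] [Fintype X] [DecidableEq X]
    (n k z : ℕ) (hn : Fintype.card X = n) (hz : 0 < z) (hzn : z < n) (hk : 1 ≤ k)
    (ropt : ℝ) (hropt0 : 0 ≤ ropt)
    (hoptmin : ∀ A : Finset X, A.card = k → ropt ≤ phi 0 z A)
    (μ : ℝ) (hμ : μ ∈ Set.Ioo (0 : ℝ) 1)
    (E : Finset X) (w : X → ℕ) (f : X → X)
    (hfE : ∀ p : X, f p ∈ E)
    (hfw : ∀ q ∈ E, (Finset.univ.filter (fun p : X => f p = q)).card = w q)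
    (hfd : ∀ p : X, dist p (f p) ≤ μ * ropt) :
    ∀ H : Finset X, H.card = k →
      |phiW w E z H - phi 0 z H| ≤ μ * ropt ∧
      (1 - μ) * phi 0 z H ≤ phiW w E z H ∧ phiW w E z H ≤ (1 + μ) * phi 0 z H := by
  intro H hH
  have hδ : 0 ≤ μ * ropt := mul_nonneg hμ.1.le hropt0
  have h₁ := phiW_le_phi_add (z := z) (H := H) hδ hfw hfd
  have h₂ := phi_le_phiW_add (z := z) (H := H) hδ hfE hfw hfd
  have h₃ := mul_le_mul_of_nonneg_left (hoptmin H hH) hμ.1.le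
  refine ⟨abs_le.2 ⟨?_, ?_⟩, ?_, ?_⟩ <;> linarith
end
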